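/- For all n ≥ 4 and p ≥ 0, A(C_n ∪ pK_1) < A(H_{3,n−3} ∪ pK_1). -/

import Mathlib

open Finset SimpleGraph

/-- A coloring partition of `G`: a partition of the vertex set into (nonempty)
independent (stable) sets. -/
def IsStablePartition {V : Type*} [Fintype V] [DecidableEq V] (G : SimpleGraph V)
    (P : Finpartition (univ : Finset V)) : Prop :=
  ∀ t ∈ P.parts, ∀ u ∈ t, ∀ v ∈ t, ¬ G.Adj u v

open scoped Classical in
/-- `colB G` : the number of coloring partitions of `G`. -/
noncomputable def colB {V : Type*} [Fintype V] [DecidableEq V] (G : SimpleGraph V) : ℕ :=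
  (univ.filter (IsStablePartition G)).card

open scoped Classical in
/-- `colT G` : the total number of blocks summed over all coloring partitions of `G`. -/
noncomputable def colT {V : Type*} [Fintype V] [DecidableEq V] (G : SimpleGraph V) : ℕ :=
  ∑ P ∈ univ.filter (IsStablePartition G), P.parts.card

/-- `colA G = colT G / colB G` : the average number of blocks. -/
noncomputable def colA {V : Type*} [Fintype V] [DecidableEq V] (G : SimpleGraph V) : ℚ :=
  (colT G : ℚ) / (colB G : ℚ)

/-- The `n`-th Bell number: the number of partitions of an `n`-element set. -/
noncomputable def bell (n : ℕ) : ℕ :=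
  Fintype.card (Finpartition (univ : Finset (Fin n)))

/-- The disjoint union of `G` with `p` isolated vertices (`G ∪ pK₁`). -/
def unionIsolated {V : Type*} (G : SimpleGraph V) (p : ℕ) : SimpleGraph (V ⊕ Fin p) :=
  SimpleGraph.fromRel (fun x y => ∃ a b, x = Sum.inl a ∧ y = Sum.inl b ∧ G.Adj a b)

/-- `Hgraph n r` : the graph obtained from the disjoint union of the cycle `C_n` and the
path `P_r` by adding an edge between one endpoint of the path (vertex `0`) and one vertex
of the cycle (vertex `0`). -/
def Hgraph (n r : ℕ) : SimpleGraph (Fin n ⊕ Fin r) :=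
  SimpleGraph.fromRel (fun x y =>
    (∃ a b, x = Sum.inl a ∧ y = Sum.inl b ∧ (cycleGraph n).Adj a b) ∨
    (∃ a b, x = Sum.inr a ∧ y = Sum.inr b ∧ (pathGraph r).Adj a b) ∨
    (∃ (a : Fin n) (b : Fin r), a.val = 0 ∧ b.val = 0 ∧ x = Sum.inl a ∧ y = Sum.inr b))


/-- A map on the vertices that separates the endpoints of every edge. -/
def IsProperColoring {V α : Type*} (G : SimpleGraph V) (f : V → α) : Prop :=
  ∀ u v, G.Adj u v → f u ≠ f v

/-- The number of proper colorings of `G` with `m` colors. -/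
noncomputable def numColorings {V : Type*} (G : SimpleGraph V) (m : ℕ) : ℕ :=
  Nat.card {f : V → Fin m // IsProperColoring G f}

section Partitions

variable {V α : Type*} [Fintype V] [DecidableEq V]

/-- The blocks of `P` are exactly the nonempty fibers of `f`. -/
def IsFiberPartition (f : V → α) (P : Finpartition (univ : Finset V)) : Prop :=
  ∀ u v, f u = f v ↔ P.part u = P.part v

lemma exists_isFiberPartition (f : V → α) : ∃ P, IsFiberPartition f P := by
  classical
  refine ⟨Finpartition.ofSetoid (Setoid.ker f), fun u v => ?_⟩
  rw [← Finpartition.mem_part_iff_part_eq_part _ (mem_univ u) (mem_univ v),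
    Finpartition.mem_part_ofSetoid_iff_rel, Setoid.ker_def, eq_comm]

lemma IsFiberPartition.unique {f : V → α} {P Q : Finpartition (univ : Finset V)}
    (hP : IsFiberPartition f P) (hQ : IsFiberPartition f Q) : P = Q := by
  have hpart : ∀ u, P.part u = Q.part u := fun u => by
    ext v
    rw [Finpartition.mem_part_iff_part_eq_part _ (mem_univ v) (mem_univ u),
      Finpartition.mem_part_iff_part_eq_part _ (mem_univ v) (mem_univ u), ← hP v u, hQ v u]
  have hparts : ∀ R : Finpartition (univ : Finset V), R.parts = univ.image R.part := fun R => by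
    ext t
    simp only [mem_image, mem_univ, true_and]
    constructor
    · intro ht
      obtain ⟨u, hu⟩ := R.nonempty_of_mem_parts ht
      exact ⟨u, R.part_eq_of_mem ht hu⟩
    · rintro ⟨u, rfl⟩
      exact R.part_mem.2 (mem_univ u)
  ext1
  rw [hparts P, hparts Q]
  exact image_congr fun u _ => hpart u

lemma IsFiberPartition.isProperColoring_iff {f : V → α} {P : Finpartition (univ : Finset V)}
    (h : IsFiberPartition f P) (G : SimpleGraph V) :
    IsProperColoring G f ↔ IsStablePartition G P := by
  constructor
  · intro hf t ht u hu v hv huv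
    exact hf u v huv ((h u v).2 ((P.part_eq_of_mem ht hu).trans (P.part_eq_of_mem ht hv).symm))
  · intro hP u v huv hfuv
    have hpart := (h u v).1 hfuv
    exact hP _ (P.part_mem.2 (mem_univ u)) u (P.mem_part_self.2 (mem_univ u)) v
      (hpart ▸ P.mem_part_self.2 (mem_univ v)) huv

/-- Maps with fiber partition `P` are the same as injective labelings of the blocks of `P`. -/
noncomputable def fiberPartitionEquiv (P : Finpartition (univ : Finset V)) :
    {f : V → α // IsFiberPartition f P} ≃ (P.parts ↪ α) where
  toFun f :=
    { toFun := fun t => f.1 (P.nonempty_of_mem_parts t.2).choose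
      inj' := fun s t hst => by
        have hpart := (f.2 _ _).1 hst
        rw [P.part_eq_of_mem s.2 (P.nonempty_of_mem_parts s.2).choose_spec,
          P.part_eq_of_mem t.2 (P.nonempty_of_mem_parts t.2).choose_spec] at hpart
        exact Subtype.ext hpart }
  invFun e := ⟨fun v => e ⟨P.part v, P.part_mem.2 (mem_univ v)⟩, fun u v => by simp⟩
  left_inv f := by
    ext v
    have hv := P.part_mem.2 (mem_univ v)
    exact (f.2 _ _).2 (P.part_eq_of_mem hv (P.nonempty_of_mem_parts hv).choose_spec)
  right_inv e := by
    ext t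
    have ht := (P.nonempty_of_mem_parts t.2).choose_spec
    exact congrArg e (Subtype.ext (P.part_eq_of_mem t.2 ht))

open scoped Classical in
lemma numColorings_eq_sum_descFactorial (G : SimpleGraph V) (m : ℕ) :
    numColorings G m = ∑ P ∈ univ.filter (IsStablePartition G), m.descFactorial P.parts.card := by
  let e : {f : V → Fin m // IsProperColoring G f} ≃
      (P : {P // IsStablePartition G P}) × {f : V → Fin m // IsFiberPartition f P.1} :=
    { toFun := fun f =>
        let h := exists_isFiberPartition f.1
        ⟨⟨h.choose, (h.choose_spec.isProperColoring_iff G).1 f.2⟩, f.1, h.choose_spec⟩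
      invFun := fun x => ⟨x.2.1, (x.2.2.isProperColoring_iff G).2 x.1.2⟩
      left_inv := fun f => rfl
      right_inv := by
        rintro ⟨⟨P, hP⟩, f, hf⟩
        have := (exists_isFiberPartition f).choose_spec.unique hf
        subst this
        rfl }
  rw [numColorings, Nat.card_congr e, Nat.card_sigma]
  simp only [Nat.card_congr (fiberPartitionEquiv _), Nat.card_eq_fintype_card,
    Fintype.card_embedding_eq, Fintype.card_fin, Fintype.card_coe]
  exact (sum_subtype _ (by simp) fun P : Finpartition (univ : Finset V) =>
    m.descFactorial P.parts.card).symm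

end Partitions

section Dobinski

lemma hasSum_descFactorial_div_factorial (k : ℕ) :
    HasSum (fun m : ℕ => (m.descFactorial k : ℝ) / m.factorial) (Real.exp 1) := by
  have hexp : HasSum (fun m : ℕ => (1 : ℝ) ^ m / m.factorial) (Real.exp 1) := by
    rw [Real.exp_eq_exp_ℝ]
    exact NormedSpace.expSeries_div_hasSum_exp 1
  have hzero : ∑ i ∈ range k, (i.descFactorial k : ℝ) / i.factorial = 0 :=
    sum_eq_zero fun i hi => by
      rw [Nat.descFactorial_of_lt (mem_range.1 hi), Nat.cast_zero, zero_div]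
  rw [← add_zero (Real.exp 1), ← hzero, ← hasSum_nat_add_iff]
  refine hexp.congr_fun fun m => ?_
  have h := Nat.factorial_mul_descFactorial (Nat.le_add_left k m)
  rw [Nat.add_sub_cancel] at h
  rw [← h]
  have h1 : (m.factorial : ℝ) ≠ 0 := by positivity
  have h2 : ((m + k).descFactorial k : ℝ) ≠ 0 := by
    exact_mod_cast (Nat.descFactorial_pos.2 (Nat.le_add_left k m)).ne'
  push_cast
  field_simp
  simp

lemma mul_descFactorial (m k : ℕ) :
    m * m.descFactorial k = m.descFactorial (k + 1) + k * m.descFactorial k := by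
  rw [Nat.descFactorial_succ, ← add_mul]
  rcases le_or_gt k m with h | h
  · rw [Nat.sub_add_cancel h]
  · simp [Nat.descFactorial_of_lt h]

variable {V : Type*} [Fintype V] [DecidableEq V]

lemma hasSum_numColorings_div_factorial (G : SimpleGraph V) :
    HasSum (fun m : ℕ => (numColorings G m : ℝ) / m.factorial) (Real.exp 1 * colB G) := by
  classical
  have h := hasSum_sum (s := univ.filter (IsStablePartition G)) fun P _ =>
    hasSum_descFactorial_div_factorial P.parts.card
  convert h using 1
  · ext m
    rw [numColorings_eq_sum_descFactorial, Nat.cast_sum, sum_div]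
  · rw [sum_const, nsmul_eq_mul, mul_comm, colB]

lemma hasSum_mul_numColorings_div_factorial (G : SimpleGraph V) :
    HasSum (fun m : ℕ => m * ((numColorings G m : ℝ) / m.factorial))
      (Real.exp 1 * (colT G + colB G)) := by
  classical
  have h := hasSum_sum (s := univ.filter (IsStablePartition G)) fun P _ =>
    (hasSum_descFactorial_div_factorial (P.parts.card + 1)).add
      ((hasSum_descFactorial_div_factorial P.parts.card).mul_left (P.parts.card : ℝ))
  convert h using 1
  · ext m
    rw [numColorings_eq_sum_descFactorial, Nat.cast_sum, sum_div, mul_sum]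
    refine sum_congr rfl fun P _ => ?_
    rw [← mul_div_assoc, ← mul_div_assoc, ← add_div]
    exact_mod_cast congrArg (fun x : ℕ => (x : ℝ) / m.factorial) (mul_descFactorial m P.parts.card)
  · rw [sum_add_distrib, sum_const, nsmul_eq_mul, ← sum_mul, colB, colT]
    push_cast
    ring

end Dobinski

section Comparison

lemma hasSum_pos_of_nonneg {ι : Type*} {f : ι → ℝ} {a : ℝ} (h : HasSum f a) (hf : ∀ i, 0 ≤ f i)
    {i : ι} (hi : 0 < f i) : 0 < a :=
  hi.trans_le (le_hasSum h i fun j _ => hf j)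

/-- If the quotient of the chromatic polynomials of `H` and `G` increases in the number of colors,
then the average number of blocks of `G` is less than that of `H`. -/
theorem colA_lt_colA_of_numColorings {V W : Type*} [Fintype V] [DecidableEq V] [Fintype W]
    [DecidableEq W] (G : SimpleGraph V) (H : SimpleGraph W)
    (hle : ∀ i j, i < j →
      numColorings H i * numColorings G j ≤ numColorings H j * numColorings G i)
    (hlt : ∃ i j, i < j ∧
      numColorings H i * numColorings G j < numColorings H j * numColorings G i) :
    colA G < colA H := by
  set g : ℕ → ℝ := fun m => (numColorings G m : ℝ) / m.factorial with hg
  set h : ℕ → ℝ := fun m => (numColorings H m : ℝ) / m.factorial with hh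
  have g_nonneg : ∀ m, 0 ≤ g m := fun m => by positivity
  have h_nonneg : ∀ m, 0 ≤ h m := fun m => by positivity
  have hG : HasSum g _ := hasSum_numColorings_div_factorial G
  have hH : HasSum h _ := hasSum_numColorings_div_factorial H
  have hG' : HasSum (fun m : ℕ => m * g m) _ := hasSum_mul_numColorings_div_factorial G
  have hH' : HasSum (fun m : ℕ => m * h m) _ := hasSum_mul_numColorings_div_factorial H
  have mul_g_nonneg : ∀ m : ℕ, 0 ≤ m * g m := fun m => by positivity
  have mul_h_nonneg : ∀ m : ℕ, 0 ≤ m * h m := fun m => by positivity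
  obtain ⟨i, j, hij, hlt⟩ := hlt
  have he := Real.exp_pos 1
  have hpos : 0 < numColorings H j * numColorings G i := hlt.trans_le' (Nat.zero_le _)
  have hBG : (0 : ℝ) < colB G := by
    have hi : 0 < g i := div_pos (by exact_mod_cast Nat.pos_of_mul_pos_left hpos) (by positivity)
    exact pos_of_mul_pos_right (hasSum_pos_of_nonneg hG g_nonneg hi) he.le
  have hBH : (0 : ℝ) < colB H := by
    have hj : 0 < h j := div_pos (by exact_mod_cast Nat.pos_of_mul_pos_right hpos) (by positivity)
    exact pos_of_mul_pos_right (hasSum_pos_of_nonneg hH h_nonneg hj) he.le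
  have term_eq : ∀ i j : ℕ, ((j : ℝ) - i) * (h j * g i - h i * g j) =
      ((j : ℝ) - i) * ((numColorings H j * numColorings G i - numColorings H i * numColorings G j) /
        (i.factorial * j.factorial)) := fun i j => by
    have h1 : (i.factorial : ℝ) ≠ 0 := by positivity
    have h2 : (j.factorial : ℝ) ≠ 0 := by positivity
    simp only [hg, hh]
    field_simp
  have term_nonneg : ∀ i j : ℕ, i < j → 0 ≤ ((j : ℝ) - i) * (h j * g i - h i * g j) :=
    fun i j hij => by
      rw [term_eq]
      have h1 : (i : ℝ) < j := by exact_mod_cast hij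
      have h2 : (numColorings H i * numColorings G j : ℝ) ≤ numColorings H j * numColorings G i := by
        exact_mod_cast hle i j hij
      exact mul_nonneg (sub_pos.2 h1).le (div_nonneg (sub_nonneg.2 h2) (by positivity))
  have hsum : HasSum (fun x : ℕ × ℕ => ((x.2 : ℝ) - x.1) * (h x.2 * g x.1 - h x.1 * g x.2))
      (2 * Real.exp 1 ^ 2 * (colT H * colB G - colT G * colB H)) := by
    have s1 := hG.mul hH' (hG.summable.mul_of_nonneg hH'.summable g_nonneg mul_h_nonneg)
    have s2 := hH'.mul hG (hH'.summable.mul_of_nonneg hG.summable mul_h_nonneg g_nonneg)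
    have s3 := hG'.mul hH (hG'.summable.mul_of_nonneg hH.summable mul_g_nonneg h_nonneg)
    have s4 := hH.mul hG' (hH.summable.mul_of_nonneg hG'.summable h_nonneg mul_g_nonneg)
    convert (s1.add s2).sub (s3.add s4) using 1
    · rfl
    · ext x
      ring
    · ring
  have htotal := hasSum_pos_of_nonneg hsum (i := (i, j)) (fun x => by
      rcases lt_trichotomy x.1 x.2 with hx | hx | hx
      · exact term_nonneg _ _ hx
      · simp [hx]
      · exact (term_nonneg _ _ hx).trans_eq (by ring)) (by
      change 0 < ((j : ℝ) - i) * (h j * g i - h i * g j)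
      rw [term_eq]
      have h1 : (i : ℝ) < j := by exact_mod_cast hij
      have h2 : (numColorings H i * numColorings G j : ℝ) < numColorings H j * numColorings G i := by
        exact_mod_cast hlt
      exact mul_pos (sub_pos.2 h1) (div_pos (sub_pos.2 h2) (by positivity)))
  have hcross : (colT G * colB H : ℝ) < colT H * colB G :=
    sub_pos.1 (pos_of_mul_pos_right htotal (by positivity))
  rw [colA, colA, div_lt_div_iff₀ (by exact_mod_cast hBG) (by exact_mod_cast hBH)]
  exact_mod_cast hcross

end Comparison

section Counting

lemma numColorings_unionIsolated {V : Type*} [Finite V] (G : SimpleGraph V) (p m : ℕ) :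
    numColorings (unionIsolated G p) m = numColorings G m * m ^ p := by
  have hiff : ∀ f : V ⊕ Fin p → Fin m, IsProperColoring (unionIsolated G p) f ↔
      IsProperColoring G (f ∘ Sum.inl) := fun f => by
    constructor
    · intro hf u v huv
      refine hf _ _ ?_
      rw [unionIsolated, SimpleGraph.fromRel_adj]
      exact ⟨by simpa using huv.ne, Or.inl ⟨u, v, rfl, rfl, huv⟩⟩
    · intro hf x y hxy
      rw [unionIsolated, SimpleGraph.fromRel_adj] at hxy
      rcases hxy.2 with ⟨a, b, rfl, rfl, hab⟩ | ⟨a, b, rfl, rfl, hab⟩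
      · exact hf a b hab
      · exact (hf a b hab).symm
  have e : {f : V ⊕ Fin p → Fin m // IsProperColoring (unionIsolated G p) f} ≃
      {f : V → Fin m // IsProperColoring G f} × (Fin p → Fin m) :=
    ((Equiv.sumArrowEquivProdArrow V (Fin p) (Fin m)).subtypeEquiv
      (q := fun x => IsProperColoring G x.1) hiff).trans
      Equiv.prodSubtypeFstEquivSubtypeProd
  rw [numColorings, Nat.card_congr e, Nat.card_prod, numColorings]
  simp

variable {α : Type*}

lemma card_subtype_finSucc [Fintype α] {k : ℕ} (p : (Fin (k + 1) → α) → Prop) :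
    Nat.card {f // p f} = ∑ a, Nat.card {f : Fin k → α // p (Fin.cons a f)} := by
  rw [← Nat.card_sigma]
  refine Nat.card_congr (Equiv.trans ?_
    (Equiv.subtypeProdEquivSigmaSubtype fun a (f : Fin k → α) => p (Fin.cons a f)))
  exact ((Fin.consEquiv fun _ => α).subtypeEquiv fun x => Iff.rfl).symm

/-- The word `f`, preceded by the letter `a`, has no two equal consecutive letters, and its last
letter satisfies `Q`. -/
def IsProperWord (Q : α → Prop) : ∀ {k : ℕ}, α → (Fin k → α) → Prop
  | 0, a, _ => Q a
  | _ + 1, a, f => f 0 ≠ a ∧ IsProperWord Q (f 0) (Fin.tail f)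

lemma isProperWord_iff (Q : α → Prop) {k : ℕ} (a : α) (f : Fin k → α) :
    IsProperWord Q a f ↔
      (∀ i : Fin k, (Fin.cons a f : Fin (k + 1) → α) i.castSucc ≠ f i) ∧
        Q ((Fin.cons a f : Fin (k + 1) → α) (Fin.last k)) := by
  induction k generalizing a with
  | zero => simp [IsProperWord]
  | succ k ih =>
    rw [IsProperWord, ih, Fin.forall_fin_succ, and_assoc, Fin.cons_self_tail]
    simp only [Fin.castSucc_zero, Fin.cons_zero, ← Fin.succ_castSucc, Fin.cons_succ, Fin.tail,
      ← Fin.succ_last, ne_comm]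

lemma card_isProperWord_succ [Fintype α] [DecidableEq α] (Q : α → Prop) (k : ℕ) (a : α) :
    Nat.card {f : Fin (k + 1) → α // IsProperWord Q a f} =
      ∑ b ∈ univ.erase a, Nat.card {f : Fin k → α // IsProperWord Q b f} := by
  rw [card_subtype_finSucc, ← Finset.add_sum_erase _ _ (mem_univ a)]
  simp only [IsProperWord, Fin.cons_zero, Fin.tail_cons]
  rw [Nat.card_eq_zero.2 (Or.inl ⟨fun f => f.2.1 rfl⟩), zero_add]
  refine sum_congr rfl fun b hb => ?_
  simp [(mem_erase.1 hb).1]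

lemma card_isProperWord_true [Fintype α] (k : ℕ) (a : α) :
    Nat.card {f : Fin k → α // IsProperWord (fun _ => True) a f} = (Fintype.card α - 1) ^ k := by
  classical
  induction k generalizing a with
  | zero => simp [IsProperWord]
  | succ k ih =>
    rw [card_isProperWord_succ, sum_congr rfl fun b _ => ih b, sum_const,
      card_erase_of_mem (mem_univ a), card_univ, smul_eq_mul, pow_succ']

lemma card_mul_card_isProperWord_ne [Fintype α] [DecidableEq α] (k : ℕ) (a b : α) :
    (Fintype.card α : ℤ) * Nat.card {f : Fin k → α // IsProperWord (· ≠ b) a f} =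
      ((Fintype.card α : ℤ) - 1) ^ (k + 1) +
        (-1) ^ (k + 1) * ((if a = b then (Fintype.card α : ℤ) else 0) - 1) := by
  induction k generalizing a with
  | zero =>
    by_cases h : a = b
    · simp [IsProperWord, h]
    · simp [IsProperWord, h]
  | succ k ih =>
    have hpos : 1 ≤ Fintype.card α := Fintype.card_pos_iff.2 ⟨a⟩
    rw [card_isProperWord_succ, Nat.cast_sum, mul_sum, sum_congr rfl fun c _ => ih c,
      sum_add_distrib, sum_const, ← mul_sum, sum_sub_distrib, sum_const,
      card_erase_of_mem (mem_univ a), card_univ, sum_ite_eq' (univ.erase a) b]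
    simp only [nsmul_eq_mul, mem_erase, mem_univ, and_true, Nat.cast_sub hpos, Nat.cast_one]
    by_cases h : a = b
    · simp [h]
      ring
    · simp [h, Ne.symm h]
      ring

lemma isProperColoring_cycleGraph_iff {k : ℕ} (a : α) (f : Fin (k + 1) → α) :
    IsProperColoring (cycleGraph (k + 2)) (Fin.cons a f : Fin (k + 2) → α) ↔
      IsProperWord (· ≠ a) a f := by
  rw [isProperWord_iff]
  constructor
  · intro h
    refine ⟨fun i => ?_, ?_⟩
    · have := h i.castSucc i.succ (by
        rw [cycleGraph_adj, ← Fin.coeSucc_eq_succ]; right; abel)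
      simpa using this
    · have := h (Fin.last _) 0 (by
        rw [cycleGraph_adj, ← Fin.last_add_one]; right; abel)
      simpa using this
  · rintro ⟨h1, h2⟩
    have key : ∀ u v : Fin (k + 2), v = u + 1 →
        (Fin.cons a f : Fin (k + 2) → α) u ≠ (Fin.cons a f : Fin (k + 2) → α) v := by
      intro u v huv
      rcases Fin.eq_castSucc_or_eq_last u with ⟨i, rfl⟩ | rfl
      · rw [huv, Fin.coeSucc_eq_succ, Fin.cons_succ]
        exact h1 i
      · rw [huv, Fin.last_add_one, Fin.cons_zero]
        exact h2
    intro u v huv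
    rw [cycleGraph_adj] at huv
    rcases huv with huv | huv
    · exact (key v u (by rw [← huv]; abel)).symm
    · exact key u v (by rw [← huv]; abel)

lemma numColorings_cycleGraph (k m : ℕ) :
    (numColorings (cycleGraph (k + 2)) m : ℤ) =
      ((m : ℤ) - 1) ^ (k + 2) + (-1) ^ (k + 2) * ((m : ℤ) - 1) := by
  rcases Nat.eq_zero_or_pos m with rfl | hm
  · have : IsEmpty {f : Fin (k + 2) → Fin 0 // IsProperColoring (cycleGraph (k + 2)) f} :=
      ⟨fun f => (f.1 0).elim0⟩
    rw [numColorings, Nat.card_of_isEmpty, Nat.cast_zero]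
    ring
  · have hm' : (m : ℤ) ≠ 0 := by exact_mod_cast hm.ne'
    apply mul_left_cancel₀ hm'
    rw [numColorings, card_subtype_finSucc]
    simp only [isProperColoring_cycleGraph_iff]
    have h := fun a : Fin m => card_mul_card_isProperWord_ne (k + 1) a a
    simp only [Fintype.card_fin, if_true] at h
    rw [Nat.cast_sum, mul_sum, sum_congr rfl fun a _ => h a]
    simp

lemma isProperColoring_Hgraph_iff {r : ℕ} (f : Fin 3 ⊕ Fin r → α) :
    IsProperColoring (Hgraph 3 r) f ↔
      Function.Injective (f ∘ Sum.inl) ∧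
        IsProperWord (fun _ => True) (f (Sum.inl 0)) (f ∘ Sum.inr) := by
  have hcycle : ∀ a b : Fin 3, (cycleGraph 3).Adj a b ↔ a ≠ b := by decide
  rw [isProperWord_iff]
  constructor
  · intro h
    refine ⟨fun a b hab => ?_, fun i => ?_, trivial⟩
    · by_contra hne
      refine h (Sum.inl a) (Sum.inl b) ?_ hab
      rw [Hgraph, SimpleGraph.fromRel_adj]
      exact ⟨by simpa using hne, Or.inl (Or.inl ⟨a, b, rfl, rfl, (hcycle a b).2 hne⟩)⟩
    · obtain ⟨i, hi⟩ := i
      cases i with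
      | zero =>
        refine h (Sum.inl 0) (Sum.inr ⟨0, hi⟩) ?_
        rw [Hgraph, SimpleGraph.fromRel_adj]
        exact ⟨by simp, Or.inl (Or.inr (Or.inr ⟨0, ⟨0, hi⟩, rfl, rfl, rfl, rfl⟩))⟩
      | succ i =>
        refine h (Sum.inr ⟨i, by omega⟩) (Sum.inr ⟨i + 1, hi⟩) ?_
        rw [Hgraph, SimpleGraph.fromRel_adj]
        exact ⟨by simp, Or.inl (Or.inr (Or.inl ⟨_, _, rfl, rfl, by simp [pathGraph_adj]⟩))⟩
  · rintro ⟨hinj, hword, -⟩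
    have hpath : ∀ a b : Fin r, a.val + 1 = b.val → f (Sum.inr a) ≠ f (Sum.inr b) := by
      rintro a ⟨b, hb⟩ rfl
      exact hword ⟨a + 1, hb⟩
    have key : ∀ x y : Fin 3 ⊕ Fin r,
        ((∃ a b, x = Sum.inl a ∧ y = Sum.inl b ∧ (cycleGraph 3).Adj a b) ∨
        (∃ a b, x = Sum.inr a ∧ y = Sum.inr b ∧ (pathGraph r).Adj a b) ∨
        (∃ (a : Fin 3) (b : Fin r), a.val = 0 ∧ b.val = 0 ∧ x = Sum.inl a ∧ y = Sum.inr b)) →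
        f x ≠ f y := by
      rintro x y (⟨a, b, rfl, rfl, hab⟩ | ⟨a, b, rfl, rfl, hab⟩ | ⟨a, ⟨b, hb⟩, ha, rfl, rfl, rfl⟩)
      · exact fun heq => hab.ne (hinj heq)
      · rcases pathGraph_adj.1 hab with hab | hab
        · exact hpath a b hab
        · exact (hpath b a hab).symm
      · obtain rfl : a = 0 := Fin.ext ha
        exact hword ⟨0, hb⟩
    intro x y hxy
    rw [Hgraph, SimpleGraph.fromRel_adj] at hxy
    exact hxy.2.elim (key x y) fun h => (key y x h).symm

lemma numColorings_Hgraph_three (r m : ℕ) :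
    numColorings (Hgraph 3 r) m = m.descFactorial 3 * (m - 1) ^ r := by
  let e : {f : Fin 3 ⊕ Fin r → Fin m // IsProperColoring (Hgraph 3 r) f} ≃
      (t : {t : Fin 3 → Fin m // Function.Injective t}) ×
        {f : Fin r → Fin m // IsProperWord (fun _ => True) (t.1 0) f} :=
    { toFun := fun f => ⟨⟨f.1 ∘ Sum.inl, ((isProperColoring_Hgraph_iff f.1).1 f.2).1⟩,
        f.1 ∘ Sum.inr, ((isProperColoring_Hgraph_iff f.1).1 f.2).2⟩
      invFun := fun x => ⟨Sum.elim x.1.1 x.2.1,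
        (isProperColoring_Hgraph_iff _).2 ⟨x.1.2, x.2.2⟩⟩
      left_inv := fun f => Subtype.ext (Sum.elim_comp_inl_inr f.1)
      right_inv := fun x => rfl }
  classical
  rw [numColorings, Nat.card_congr e, Nat.card_sigma]
  simp only [card_isProperWord_true, Fintype.card_fin, sum_const, smul_eq_mul, card_univ]
  rw [Fintype.card_congr (Equiv.subtypeInjectiveEquivEmbedding (Fin 3) (Fin m)),
    Fintype.card_embedding_eq, Fintype.card_fin, Fintype.card_fin]

end Counting

section Arithmetic

/-- The cross difference of the chromatic polynomials of `H_{3,k+1}` and `C_{k+4}`, written in terms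
of the number of colors minus one. -/
lemma cross_sub_cross_eq (k : ℕ) (x y s : ℤ) :
    (y ^ 2 - 1) * y ^ (k + 2) * (x ^ (k + 4) + s * x) -
        (x ^ 2 - 1) * x ^ (k + 2) * (y ^ (k + 4) + s * y) =
      x * y * (x ^ (k + 1) * y ^ (k + 1) * (y ^ 2 - x ^ 2) +
        s * (y ^ (k + 1) * (y ^ 2 - 1) - x ^ (k + 1) * (x ^ 2 - 1))) := by
  ring

lemma cross_pos {k : ℕ} {x y : ℤ} (hx2 : 2 ≤ x) (hxy : x < y) :
    0 < x ^ (k + 1) * y ^ (k + 1) * (y ^ 2 - x ^ 2) +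
        (-1) ^ k * (y ^ (k + 1) * (y ^ 2 - 1) - x ^ (k + 1) * (x ^ 2 - 1)) := by
  have hx : 1 ≤ x := by omega
  have hsq : 1 ≤ y ^ 2 - x ^ 2 := by nlinarith
  have ha : 1 ≤ x ^ (k + 1) := one_le_pow₀ hx
  have hab : x ^ (k + 1) ≤ y ^ (k + 1) := pow_le_pow_left₀ (by omega) hxy.le _
  rcases Nat.even_or_odd k with hk | hk
  · rw [hk.neg_one_pow, one_mul]
    have h1 : x ^ (k + 1) * (x ^ 2 - 1) ≤ y ^ (k + 1) * (y ^ 2 - 1) :=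
      mul_le_mul hab (by omega) (by nlinarith) (by omega)
    have h2 : 0 < x ^ (k + 1) * y ^ (k + 1) * (y ^ 2 - x ^ 2) :=
      mul_pos (mul_pos (by omega) (by omega)) (by omega)
    omega
  · have hpow : x ^ 2 ≤ x ^ (k + 1) := pow_le_pow_right₀ hx (by have := hk.pos; omega)
    rw [hk.neg_one_pow]
    generalize x ^ (k + 1) = a at *
    generalize y ^ (k + 1) = b at *
    have h1 : (b - a) * (x ^ 2 - 1) < b * (x ^ 2 - 1) :=
      mul_lt_mul_of_pos_right (by omega) (by nlinarith)
    have h2 : b * (x ^ 2 - 1) ≤ b * (a - 1) := mul_le_mul_of_nonneg_left (by omega) (by omega)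
    have h3 : b * (a - 1) * 1 ≤ b * (a - 1) * (y ^ 2 - x ^ 2) :=
      mul_le_mul_of_nonneg_left hsq (mul_nonneg (by omega) (by omega))
    linarith

lemma numColorings_Hgraph_succ (k y : ℕ) :
    (numColorings (Hgraph 3 (k + 1)) (y + 1) : ℤ) = ((y : ℤ) ^ 2 - 1) * (y : ℤ) ^ (k + 2) := by
  rw [numColorings_Hgraph_three, Nat.add_sub_cancel]
  cases y with
  | zero => simp
  | succ y =>
    simp only [Nat.succ_descFactorial_succ, Nat.descFactorial_one]
    push_cast
    ring

lemma numColorings_cycleGraph_succ (k y : ℕ) :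
    (numColorings (cycleGraph (k + 4)) (y + 1) : ℤ) = (y : ℤ) ^ (k + 4) + (-1) ^ k * y := by
  rw [numColorings_cycleGraph (k + 2)]
  push_cast
  ring

lemma numColorings_cross_lt {k i j : ℕ} (hi : 3 ≤ i) (hij : i < j) :
    numColorings (Hgraph 3 (k + 1)) i * numColorings (cycleGraph (k + 4)) j <
      numColorings (Hgraph 3 (k + 1)) j * numColorings (cycleGraph (k + 4)) i := by
  obtain ⟨x, rfl⟩ : ∃ x, i = x + 1 := ⟨i - 1, by omega⟩
  obtain ⟨y, rfl⟩ : ∃ y, j = y + 1 := ⟨j - 1, by omega⟩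
  zify
  rw [numColorings_Hgraph_succ, numColorings_Hgraph_succ, numColorings_cycleGraph_succ,
    numColorings_cycleGraph_succ, ← sub_pos, cross_sub_cross_eq]
  exact mul_pos (by norm_cast; exact Nat.mul_pos (by omega) (by omega))
    (cross_pos (by omega) (by omega))

lemma numColorings_cross_le {k i j : ℕ} (hij : i < j) :
    numColorings (Hgraph 3 (k + 1)) i * numColorings (cycleGraph (k + 4)) j ≤
      numColorings (Hgraph 3 (k + 1)) j * numColorings (cycleGraph (k + 4)) i := by
  rcases le_or_gt 3 i with hi | hi
  · exact (numColorings_cross_lt hi hij).le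
  · rw [numColorings_Hgraph_three, Nat.descFactorial_of_lt hi, zero_mul, zero_mul]
    exact Nat.zero_le _

end Arithmetic

/-- For all `n ≥ 4` and `p ≥ 0`, `A(C_n ∪ pK₁) < A(H_{3,n-3} ∪ pK₁)`. -/
theorem stmt_14 (n p : ℕ) (hn : 4 ≤ n) :
    colA (unionIsolated (cycleGraph n) p) < colA (unionIsolated (Hgraph 3 (n - 3)) p) := by
  obtain ⟨k, rfl⟩ := Nat.exists_eq_add_of_le' hn
  rw [show k + 4 - 3 = k + 1 by omega]
  apply colA_lt_colA_of_numColorings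
  · intro i j hij
    simp only [numColorings_unionIsolated]
    rw [mul_mul_mul_comm, mul_mul_mul_comm _ (j ^ p), mul_comm (j ^ p)]
    exact Nat.mul_le_mul_right _ (numColorings_cross_le hij)
  · refine ⟨3, 4, by omega, ?_⟩
    simp only [numColorings_unionIsolated]
    rw [mul_mul_mul_comm, mul_mul_mul_comm _ (4 ^ p), mul_comm (4 ^ p)]
    exact Nat.mul_lt_mul_of_pos_right (numColorings_cross_lt le_rfl (by omega)) (by positivity)
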